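/- Let G be an abelian group with neutral element e. (i) For any g₁,g₂ ∈ G and any g,h ∈ G with h² = e ≠ h, the gradings Γ¹_{K₁₀}(G;g₁,g₂) and Γ²_{K₁₀}(G;g,h) on K₁₀ are not isomorphic. (ii) Γ¹_{K₁₀}(G;g₁,g₂) is isomorphic to Γ¹_{K₁₀}(G;g₁',g₂') if and only if the sets {g₁, g₁⁻¹, g₂, g₂⁻¹} and {g₁', (g₁')⁻¹, g₂', (g₂')⁻¹} coincide. (iii) For g,h,g',h' ∈ G with h² = e ≠ h and (h')² = e ≠ h', Γ²_{K₁₀}(G;g,h) is isomorphic to Γ²_{K₁₀}(G;g',h') if and only if h' = h and g' ∈ {g, gh, g⁻¹, g⁻¹h}. -/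

import Mathlib

open scoped TensorProduct
noncomputable section
namespace Kac

/-! ### Superalgebra isomorphisms and automorphisms -/

@[ext]
structure SuperIso (S A B : Type) [CommRing S]
    [AddCommGroup A] [Module S A] [Mul A]
    [AddCommGroup B] [Module S B] [Mul B]
    (evA odA : Submodule S A) (evB odB : Submodule S B) : Type where
  e : A ≃ₗ[S] B
  map_mul' : ∀ x y : A, e (x * y) = e x * e y
  map_even : evA.map e.toLinearMap = evB
  map_odd : odA.map e.toLinearMap = odB

abbrev SuperAut (S A : Type) [CommRing S] [AddCommGroup A] [Module S A] [Mul A]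
    (ev od : Submodule S A) := SuperIso S A A ev od ev od

namespace SuperAut

variable {S A : Type} [CommRing S] [AddCommGroup A] [Module S A] [Mul A]
variable {ev od : Submodule S A}

private lemma map_symm {f : A ≃ₗ[S] A} {p : Submodule S A}
    (h : p.map f.toLinearMap = p) : p.map f.symm.toLinearMap = p := by
  have h2 : f.symm.toLinearMap.comp f.toLinearMap = LinearMap.id := by
    ext x; simp
  calc p.map f.symm.toLinearMap
      = (p.map f.toLinearMap).map f.symm.toLinearMap := by rw [h]
    _ = p.map (f.symm.toLinearMap.comp f.toLinearMap) := by
        rw [Submodule.map_comp]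
    _ = p := by rw [h2, Submodule.map_id]

instance : Group (SuperAut S A ev od) where
  one := ⟨LinearEquiv.refl S A, fun _ _ => rfl, Submodule.map_id _, Submodule.map_id _⟩
  mul f g := ⟨g.e.trans f.e,
    fun x y => by simp [LinearEquiv.trans_apply, g.map_mul', f.map_mul'],
    by rw [LinearEquiv.coe_trans, Submodule.map_comp, g.map_even, f.map_even],
    by rw [LinearEquiv.coe_trans, Submodule.map_comp, g.map_odd, f.map_odd]⟩
  inv f := ⟨f.e.symm,
    fun x y => f.e.injective <| by simp [f.map_mul'],
    map_symm f.map_even, map_symm f.map_odd⟩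
  mul_assoc f g h := by apply SuperIso.ext; apply LinearEquiv.ext; intro x; rfl
  one_mul f := by apply SuperIso.ext; apply LinearEquiv.ext; intro x; rfl
  mul_one f := by apply SuperIso.ext; apply LinearEquiv.ext; intro x; rfl
  inv_mul_cancel f := by
    apply SuperIso.ext; apply LinearEquiv.ext; intro x
    exact f.e.symm_apply_apply x

end SuperAut

/-- The predicate that a pair of submodules `ev`, `od` makes a non-unital
(possibly non-associative) algebra `B` into a superalgebra. -/
def IsSuperalgebra (S B : Type) [CommRing S] [NonUnitalNonAssocRing B] [Module S B]
    (ev od : Submodule S B) : Prop :=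
  ev ⊔ od = ⊤ ∧ ev ⊓ od = ⊥ ∧
  (∀ x ∈ ev, ∀ y ∈ ev, x * y ∈ ev) ∧ (∀ x ∈ ev, ∀ y ∈ od, x * y ∈ od) ∧
  (∀ x ∈ od, ∀ y ∈ ev, x * y ∈ od) ∧ (∀ x ∈ od, ∀ y ∈ od, x * y ∈ ev)

/-! ### Submodules given by vanishing of coordinates -/

def stdSub (S R : Type) [Semiring S] [AddCommGroup R] [Module S R] (n : ℕ)
    (s : Set (Fin n)) : Submodule S (Fin n → R) where
  carrier := {x | ∀ i, i ∉ s → x i = 0}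
  add_mem' := fun {a b} ha hb i hi => by
    simp [Pi.add_apply, ha i hi, hb i hi]
  zero_mem' := fun i _ => rfl
  smul_mem' := fun c x hx i hi => by
    simp [Pi.smul_apply, hx i hi]

/-! ### Gradings by abelian groups -/

section Gradings

variable {G H S A : Type} [CommGroup G] [CommGroup H] [CommRing S]
  [AddCommGroup A] [Module S A] [Mul A]

/-- `comp` is a `G`-grading of the superalgebra `(A, ev, od)`. -/
def IsSuperGrading (ev od : Submodule S A) (comp : G → Submodule S A) : Prop :=
  (letI := Classical.decEq G; DirectSum.IsInternal comp) ∧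
  (∀ (g h : G) (x y : A), x ∈ comp g → y ∈ comp h → x * y ∈ comp (g * h)) ∧
  (∀ g, comp g = (comp g ⊓ ev) ⊔ (comp g ⊓ od))

/-- The grading with homogeneous elements `w i` of degrees `d i`. -/
def gradingOf (S : Type) {A G : Type} [CommRing S] [AddCommGroup A] [Module S A]
    [CommGroup G] {n : ℕ} (w : Fin n → A) (d : Fin n → G) : G → Submodule S A :=
  fun g => Submodule.span S (w '' {i | d i = g})

/-- Isomorphism of two `G`-gradings on a superalgebra. -/
def GradIso (ev od : Submodule S A) (comp comp' : G → Submodule S A) : Prop :=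
  ∃ φ : SuperAut S A ev od, ∀ g, (comp g).map φ.e.toLinearMap = comp' g

/-- `Δ` refines `Γ`. -/
def Refines (Δ : H → Submodule S A) (Γ : G → Submodule S A) : Prop :=
  ∀ h, Δ h ≠ ⊥ → ∃ g, Δ h ≤ Γ g

/-- Equivalence of a `G`-grading and an `H`-grading on a superalgebra. -/
def GradEquiv (ev od : Submodule S A) (Γ : G → Submodule S A)
    (Δ : H → Submodule S A) : Prop :=
  ∃ φ : SuperAut S A ev od, ∃ α : {g : G // Γ g ≠ ⊥} → {h : H // Δ h ≠ ⊥},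
    Function.Bijective α ∧
    ∀ g : {g : G // Γ g ≠ ⊥}, (Γ g.1).map φ.e.toLinearMap = Δ (α g).1

/-- A grading is fine if any grading refining it has the same nonzero
homogeneous components. -/
def IsFine (ev od : Submodule S A) (Γ : G → Submodule S A) : Prop :=
  ∀ (H : Type) (_ : CommGroup H) (Δ : H → Submodule S A),
    IsSuperGrading ev od Δ → Refines Δ Γ →
      {p : Submodule S A | p ≠ ⊥ ∧ ∃ h, Δ h = p} =
      {p : Submodule S A | p ≠ ⊥ ∧ ∃ g, Γ g = p}

end Gradings

/-! ### SL₂ and the semidirect product with C₂ -/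

abbrev SL2 (R : Type) [CommRing R] := Matrix.SpecialLinearGroup (Fin 2) R

def swapAut (M : Type) [Monoid M] : MulAut (M × M) := MulEquiv.prodComm

lemma swapAut_sq (M : Type) [Monoid M] : swapAut M * swapAut M = 1 :=
  MulEquiv.ext fun _ => rfl

/-- The action of `C₂ = Multiplicative (ZMod 2)` on `M × M` by swapping the factors. -/
def swapHom (M : Type) [Group M] : Multiplicative (ZMod 2) →* MulAut (M × M) :=
  MonoidHom.mk' (fun c => if c.toAdd = 0 then 1 else swapAut M) (by
    intro a b
    have key : ∀ c : Multiplicative (ZMod 2),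
        c = Multiplicative.ofAdd 0 ∨ c = Multiplicative.ofAdd 1 := by decide
    rcases key a with rfl | rfl <;> rcases key b with rfl | rfl <;>
      simp [← ofAdd_add, swapAut_sq] <;> exact fun h => absurd (by decide) h)

end Kac
/-! ### The (base-changed) Kaplansky superalgebra `K₃ ⊗ R` -/

namespace Kac

section Algebras

variable (F : Type) [Field F] (R : Type) [CommRing R] [Algebra F R]

/-- Coordinates: `0 ↦ a`, `1 ↦ u`, `2 ↦ v`. -/
def K3A (F : Type) [Field F] (R : Type) [CommRing R] [Algebra F R] : Type := Fin 3 → R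

instance : AddCommGroup (K3A F R) := Pi.addCommGroup
instance (S : Type) [Semiring S] [Module S R] : Module S (K3A F R) := Pi.module _ _ _

namespace K3A
variable {F R}

def mulFun (x y : K3A F R) : K3A F R := fun i =>
  match i with
  | ⟨0, _⟩ => x 0 * y 0 + (x 1 * y 2 - x 2 * y 1)
  | ⟨1, _⟩ => algebraMap F R 2⁻¹ * (x 0 * y 1 + y 0 * x 1)
  | ⟨2, _⟩ => algebraMap F R 2⁻¹ * (x 0 * y 2 + y 0 * x 2)

instance : Mul (K3A F R) := ⟨mulFun⟩

lemma mul_def (x y : K3A F R) : x * y = mulFun x y := rfl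

@[simp] lemma add_apply (x y : K3A F R) (i : Fin 3) : (x + y) i = x i + y i := rfl
@[simp] lemma sub_apply (x y : K3A F R) (i : Fin 3) : (x - y) i = x i - y i := rfl
@[simp] lemma neg_apply (x : K3A F R) (i : Fin 3) : (-x) i = -(x i) := rfl
@[simp] lemma zero_apply (i : Fin 3) : (0 : K3A F R) i = 0 := rfl
@[simp] lemma smul_apply (S : Type) [Semiring S] [Module S R] (c : S) (x : K3A F R) (i : Fin 3) :
    (c • x) i = c • (x i) := rfl

variable (F R)

/-- The even part `R·a`. -/
def even (S : Type) [Semiring S] [Module S R] : Submodule S (K3A F R) := stdSub S R 3 {0}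
/-- The odd part `W ⊗ R`. -/
def odd (S : Type) [Semiring S] [Module S R] : Submodule S (K3A F R) := stdSub S R 3 {1, 2}

/-- The element `a`. -/
def aE : K3A F R := ![1, 0, 0]
/-- The element of `W ⊗ R` with coordinates `w` in the symplectic basis `{u, v}`. -/
def wE (w : Fin 2 → R) : K3A F R := ![0, w 0, w 1]

end K3A

/-- `J(W) ⊗ R`; coordinates: `0 ↦ 1`, `1 ↦ u`, `2 ↦ v`. -/
def JW1A (R : Type) [CommRing R] : Type := Fin 3 → R

instance : AddCommGroup (JW1A R) := Pi.addCommGroup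
instance (S : Type) [Semiring S] [Module S R] : Module S (JW1A R) := Pi.module _ _ _

namespace JW1A
variable {R}

def mulFun (x y : JW1A R) : JW1A R := fun i =>
  match i with
  | ⟨0, _⟩ => x 0 * y 0 + (x 1 * y 2 - x 2 * y 1)
  | ⟨1, _⟩ => x 0 * y 1 + y 0 * x 1
  | ⟨2, _⟩ => x 0 * y 2 + y 0 * x 2

instance : Mul (JW1A R) := ⟨mulFun⟩

lemma mul_def (x y : JW1A R) : x * y = mulFun x y := rfl

@[simp] lemma add_apply (x y : JW1A R) (i : Fin 3) : (x + y) i = x i + y i := rfl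
@[simp] lemma sub_apply (x y : JW1A R) (i : Fin 3) : (x - y) i = x i - y i := rfl
@[simp] lemma neg_apply (x : JW1A R) (i : Fin 3) : (-x) i = -(x i) := rfl
@[simp] lemma zero_apply (i : Fin 3) : (0 : JW1A R) i = 0 := rfl
@[simp] lemma smul_apply (S : Type) [Semiring S] [Module S R] (c : S) (x : JW1A R) (i : Fin 3) :
    (c • x) i = c • (x i) := rfl

variable (R)

def even (S : Type) [Semiring S] [Module S R] : Submodule S (JW1A R) := stdSub S R 3 {0}
def odd (S : Type) [Semiring S] [Module S R] : Submodule S (JW1A R) := stdSub S R 3 {1, 2}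

def oneE : JW1A R := ![1, 0, 0]
def wE (w : Fin 2 → R) : JW1A R := ![0, w 0, w 1]

end JW1A

/-- `(K₃ × K₃) ⊗ R`; coordinates `0,1,2` for the first copy (`a,u,v`),
`3,4,5` for the second copy. -/
def K33A (F : Type) [Field F] (R : Type) [CommRing R] [Algebra F R] : Type := Fin 6 → R

instance : AddCommGroup (K33A F R) := Pi.addCommGroup
instance (S : Type) [Semiring S] [Module S R] : Module S (K33A F R) := Pi.module _ _ _

namespace K33A
variable {F R}

def mulFun (x y : K33A F R) : K33A F R := fun i =>
  match i with
  | ⟨0, _⟩ => x 0 * y 0 + (x 1 * y 2 - x 2 * y 1)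
  | ⟨1, _⟩ => algebraMap F R 2⁻¹ * (x 0 * y 1 + y 0 * x 1)
  | ⟨2, _⟩ => algebraMap F R 2⁻¹ * (x 0 * y 2 + y 0 * x 2)
  | ⟨3, _⟩ => x 3 * y 3 + (x 4 * y 5 - x 5 * y 4)
  | ⟨4, _⟩ => algebraMap F R 2⁻¹ * (x 3 * y 4 + y 3 * x 4)
  | ⟨5, _⟩ => algebraMap F R 2⁻¹ * (x 3 * y 5 + y 3 * x 5)

instance : Mul (K33A F R) := ⟨mulFun⟩

lemma mul_def (x y : K33A F R) : x * y = mulFun x y := rfl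

@[simp] lemma add_apply (x y : K33A F R) (i : Fin 6) : (x + y) i = x i + y i := rfl
@[simp] lemma sub_apply (x y : K33A F R) (i : Fin 6) : (x - y) i = x i - y i := rfl
@[simp] lemma neg_apply (x : K33A F R) (i : Fin 6) : (-x) i = -(x i) := rfl
@[simp] lemma zero_apply (i : Fin 6) : (0 : K33A F R) i = 0 := rfl
@[simp] lemma smul_apply (S : Type) [Semiring S] [Module S R] (c : S) (x : K33A F R) (i : Fin 6) :
    (c • x) i = c • (x i) := rfl

variable (F R)

def even (S : Type) [Semiring S] [Module S R] : Submodule S (K33A F R) := stdSub S R 6 {0, 3}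
def odd (S : Type) [Semiring S] [Module S R] : Submodule S (K33A F R) := stdSub S R 6 {1, 2, 4, 5}

/-- The element `(a, 0)`. -/
def aLeft : K33A F R := ![1, 0, 0, 0, 0, 0]
/-- The element `(0, a)`. -/
def aRight : K33A F R := ![0, 0, 0, 1, 0, 0]
/-- The element `(v, w)` of the odd part, `v, w ∈ W ⊗ R`. -/
def oddE (w w' : Fin 2 → R) : K33A F R := ![0, w 0, w 1, 0, w' 0, w' 1]
/-- The exchange automorphism `(x, y) ↦ (y, x)`. -/
def swapFun (x : K33A F R) : K33A F R := fun i =>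
  match i with
  | ⟨0, _⟩ => x 3
  | ⟨1, _⟩ => x 4
  | ⟨2, _⟩ => x 5
  | ⟨3, _⟩ => x 0
  | ⟨4, _⟩ => x 1
  | ⟨5, _⟩ => x 2

end K33A

/-- `(J(W) × J(W)) ⊗ R`. -/
def JW2A (R : Type) [CommRing R] : Type := Fin 6 → R

instance : AddCommGroup (JW2A R) := Pi.addCommGroup
instance (S : Type) [Semiring S] [Module S R] : Module S (JW2A R) := Pi.module _ _ _

namespace JW2A
variable {R}

def mulFun (x y : JW2A R) : JW2A R := fun i =>
  match i with
  | ⟨0, _⟩ => x 0 * y 0 + (x 1 * y 2 - x 2 * y 1)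
  | ⟨1, _⟩ => x 0 * y 1 + y 0 * x 1
  | ⟨2, _⟩ => x 0 * y 2 + y 0 * x 2
  | ⟨3, _⟩ => x 3 * y 3 + (x 4 * y 5 - x 5 * y 4)
  | ⟨4, _⟩ => x 3 * y 4 + y 3 * x 4
  | ⟨5, _⟩ => x 3 * y 5 + y 3 * x 5

instance : Mul (JW2A R) := ⟨mulFun⟩

lemma mul_def (x y : JW2A R) : x * y = mulFun x y := rfl

@[simp] lemma add_apply (x y : JW2A R) (i : Fin 6) : (x + y) i = x i + y i := rfl
@[simp] lemma sub_apply (x y : JW2A R) (i : Fin 6) : (x - y) i = x i - y i := rfl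
@[simp] lemma neg_apply (x : JW2A R) (i : Fin 6) : (-x) i = -(x i) := rfl
@[simp] lemma zero_apply (i : Fin 6) : (0 : JW2A R) i = 0 := rfl
@[simp] lemma smul_apply (S : Type) [Semiring S] [Module S R] (c : S) (x : JW2A R) (i : Fin 6) :
    (c • x) i = c • (x i) := rfl

variable (R)

def even (S : Type) [Semiring S] [Module S R] : Submodule S (JW2A R) := stdSub S R 6 {0, 3}
def odd (S : Type) [Semiring S] [Module S R] : Submodule S (JW2A R) := stdSub S R 6 {1, 2, 4, 5}

/-- The element `(1, 0)`. -/
def oneLeft : JW2A R := ![1, 0, 0, 0, 0, 0]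
/-- The element `(0, 1)`. -/
def oneRight : JW2A R := ![0, 0, 0, 1, 0, 0]
def oddE (w w' : Fin 2 → R) : JW2A R := ![0, w 0, w 1, 0, w' 0, w' 1]
def swapFun (x : JW2A R) : JW2A R := fun i =>
  match i with
  | ⟨0, _⟩ => x 3
  | ⟨1, _⟩ => x 4
  | ⟨2, _⟩ => x 5
  | ⟨3, _⟩ => x 0
  | ⟨4, _⟩ => x 1
  | ⟨5, _⟩ => x 2

end JW2A

/-- Kac's superalgebra `K₁₀ ⊗ R`.  CoordinatesL `0 ↦ 1`, `1 ↦ a⊗a`,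
`2 ↦ u⊗u`, `3 ↦ u⊗v`, `4 ↦ v⊗u`, `5 ↦ v⊗v`, `6 ↦ u⊗a`, `7 ↦ v⊗a`,
`8 ↦ a⊗u`, `9 ↦ a⊗v`. -/
def K10A (F : Type) [Field F] (R : Type) [CommRing R] [Algebra F R] : Type := Fin 10 → R

instance : AddCommGroup (K10A F R) := Pi.addCommGroup
instance (S : Type) [Semiring S] [Module S R] : Module S (K10A F R) := Pi.module _ _ _

namespace K10A
variable {F R}

def mulFun (x y : K10A F R) : K10A F R := fun i =>
  match i with
  | ⟨0, _⟩ => x 0 * y 0 - algebraMap F R (3/16) * (x 1 * y 1)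
      + algebraMap F R (3/4) * (x 2 * y 5 + x 5 * y 2 - x 3 * y 4 - x 4 * y 3)
      - algebraMap F R (3/8) * (x 6 * y 7 - x 7 * y 6 + x 8 * y 9 - x 9 * y 8)
  | ⟨1, _⟩ => x 0 * y 1 + x 1 * y 0 + x 1 * y 1
      - (x 2 * y 5 + x 5 * y 2 - x 3 * y 4 - x 4 * y 3)
      + (x 6 * y 7 - x 7 * y 6) + (x 8 * y 9 - x 9 * y 8)
  | ⟨2, _⟩ => x 0 * y 2 + x 2 * y 0 + algebraMap F R 4⁻¹ * (x 1 * y 2 + x 2 * y 1)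
      + algebraMap F R 4⁻¹ * (x 6 * y 8 - x 8 * y 6)
  | ⟨3, _⟩ => x 0 * y 3 + x 3 * y 0 + algebraMap F R 4⁻¹ * (x 1 * y 3 + x 3 * y 1)
      + algebraMap F R 4⁻¹ * (x 6 * y 9 - x 9 * y 6)
  | ⟨4, _⟩ => x 0 * y 4 + x 4 * y 0 + algebraMap F R 4⁻¹ * (x 1 * y 4 + x 4 * y 1)
      + algebraMap F R 4⁻¹ * (x 7 * y 8 - x 8 * y 7)
  | ⟨5, _⟩ => x 0 * y 5 + x 5 * y 0 + algebraMap F R 4⁻¹ * (x 1 * y 5 + x 5 * y 1)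
      + algebraMap F R 4⁻¹ * (x 7 * y 9 - x 9 * y 7)
  | ⟨6, _⟩ => x 0 * y 6 + x 6 * y 0 + algebraMap F R 2⁻¹ * (x 1 * y 6 + x 6 * y 1)
      + algebraMap F R 2⁻¹ * (x 2 * y 9 + x 9 * y 2) - algebraMap F R 2⁻¹ * (x 3 * y 8 + x 8 * y 3)
  | ⟨7, _⟩ => x 0 * y 7 + x 7 * y 0 + algebraMap F R 2⁻¹ * (x 1 * y 7 + x 7 * y 1)
      + algebraMap F R 2⁻¹ * (x 4 * y 9 + x 9 * y 4) - algebraMap F R 2⁻¹ * (x 5 * y 8 + x 8 * y 5)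
  | ⟨8, _⟩ => x 0 * y 8 + x 8 * y 0 + algebraMap F R 2⁻¹ * (x 1 * y 8 + x 8 * y 1)
      - algebraMap F R 2⁻¹ * (x 2 * y 7 + x 7 * y 2) + algebraMap F R 2⁻¹ * (x 4 * y 6 + x 6 * y 4)
  | ⟨9, _⟩ => x 0 * y 9 + x 9 * y 0 + algebraMap F R 2⁻¹ * (x 1 * y 9 + x 9 * y 1)
      - algebraMap F R 2⁻¹ * (x 3 * y 7 + x 7 * y 3) + algebraMap F R 2⁻¹ * (x 5 * y 6 + x 6 * y 5)

instance : Mul (K10A F R) := ⟨mulFun⟩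

lemma mul_def (x y : K10A F R) : x * y = mulFun x y := rfl

@[simp] lemma add_apply (x y : K10A F R) (i : Fin 10) : (x + y) i = x i + y i := rfl
@[simp] lemma sub_apply (x y : K10A F R) (i : Fin 10) : (x - y) i = x i - y i := rfl
@[simp] lemma neg_apply (x : K10A F R) (i : Fin 10) : (-x) i = -(x i) := rfl
@[simp] lemma zero_apply (i : Fin 10) : (0 : K10A F R) i = 0 := rfl
@[simp] lemma smul_apply (S : Type) [Semiring S] [Module S R] (c : S) (x : K10A F R) (i : Fin 10) :
    (c • x) i = c • (x i) := rfl

variable (F R)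

def even (S : Type) [Semiring S] [Module S R] : Submodule S (K10A F R) :=
  stdSub S R 10 {0, 1, 2, 3, 4, 5}
def odd (S : Type) [Semiring S] [Module S R] : Submodule S (K10A F R) :=
  stdSub S R 10 {6, 7, 8, 9}

/-- The unity `1`. -/
def oneE : K10A F R := ![1, 0, 0, 0, 0, 0, 0, 0, 0, 0]
/-- The element `a ⊗ a`. -/
def aaE : K10A F R := ![0, 1, 0, 0, 0, 0, 0, 0, 0, 0]
/-- The element `v ⊗ w ∈ W ⊗ W`. -/
def wwE (w w' : Fin 2 → R) : K10A F R :=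
  ![0, 0, w 0 * w' 0, w 0 * w' 1, w 1 * w' 0, w 1 * w' 1, 0, 0, 0, 0]
/-- The element `w ⊗ a`, `w ∈ W ⊗ R`. -/
def waE (w : Fin 2 → R) : K10A F R := ![0, 0, 0, 0, 0, 0, w 0, w 1, 0, 0]
/-- The element `a ⊗ w`, `w ∈ W ⊗ R`. -/
def awE (w : Fin 2 → R) : K10A F R := ![0, 0, 0, 0, 0, 0, 0, 0, w 0, w 1]
/-- The exchange automorphism `τ`, `τ(x ⊗ y) = (-1)^{|x||y|} y ⊗ x`. -/
def tauFun (x : K10A F R) : K10A F R := fun i =>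
  match i with
  | ⟨0, _⟩ => x 0
  | ⟨1, _⟩ => x 1
  | ⟨2, _⟩ => -x 2
  | ⟨3, _⟩ => -x 4
  | ⟨4, _⟩ => -x 3
  | ⟨5, _⟩ => -x 5
  | ⟨6, _⟩ => x 8
  | ⟨7, _⟩ => x 9
  | ⟨8, _⟩ => x 6
  | ⟨9, _⟩ => x 7

end K10A

end Algebras

end Kac

namespace Kac

section GradingDefs

variable (F : Type) [Field F] {G : Type} [CommGroup G]

/-- Standard basis of `K₃ × K₃` (`a₁, u₁, v₁, a₂, u₂, v₂`). -/
def K33A.bv (i : Fin 6) : K33A F F := Pi.single i 1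

/-- The grading `Γ¹(G; g₁, g₂)` on `K₃ × K₃`: all even elements have degree
`e`, `deg (u,0) = g₁ = deg (v,0)⁻¹`, `deg (0,u) = g₂ = deg (0,v)⁻¹`. -/
def K33A.gamma1 (g1 g2 : G) : G → Submodule F (K33A F F) :=
  gradingOf F (K33A.bv F) ![1, g1, g1⁻¹, 1, g2, g2⁻¹]

/-- The grading `Γ²(G; g, h)` on `K₃ × K₃` (`h² = e ≠ h`):
`deg (a,a) = e`, `deg (a,-a) = h`, `deg (u,u) = g = deg (v,v)⁻¹`,
`deg (u,-u) = gh = deg (v,-v)⁻¹`. -/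
def K33A.gamma2 (g h : G) : G → Submodule F (K33A F F) :=
  gradingOf F
    ![K33A.bv F 0 + K33A.bv F 3, K33A.bv F 0 - K33A.bv F 3,
      K33A.bv F 1 + K33A.bv F 4, K33A.bv F 2 + K33A.bv F 5,
      K33A.bv F 1 - K33A.bv F 4, K33A.bv F 2 - K33A.bv F 5]
    ![1, h, g, g⁻¹, g * h, g⁻¹ * h]

/-- Standard (homogeneous) basis of `K₁₀`:
`1, a⊗a, u⊗u, u⊗v, v⊗u, v⊗v, u⊗a, v⊗a, a⊗u, a⊗v`. -/
def K10A.bv (i : Fin 10) : K10A F F := Pi.single i 1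

/-- The grading `Γ¹_{K₁₀}(G; g₁, g₂)` on `K₁₀`, determined by
`deg (u⊗a) = g₁ = deg (v⊗a)⁻¹`, `deg (a⊗u) = g₂ = deg (a⊗v)⁻¹`. -/
def K10A.gamma1 (g1 g2 : G) : G → Submodule F (K10A F F) :=
  gradingOf F (K10A.bv F)
    ![1, 1, g1 * g2, g1 * g2⁻¹, g1⁻¹ * g2, g1⁻¹ * g2⁻¹, g1, g1⁻¹, g2, g2⁻¹]

/-- The grading `Γ²_{K₁₀}(G; g, h)` on `K₁₀` (`h² = e ≠ h`), determined by
`deg (u⊗a + a⊗u) = g = deg (v⊗a + a⊗v)⁻¹`,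
`deg (u⊗a - a⊗u) = gh = deg (v⊗a - a⊗v)⁻¹`. -/
def K10A.gamma2 (g h : G) : G → Submodule F (K10A F F) :=
  gradingOf F
    ![K10A.bv F 0, K10A.bv F 1, K10A.bv F 3 - K10A.bv F 4,
      K10A.bv F 3 + K10A.bv F 4, K10A.bv F 2, K10A.bv F 5,
      K10A.bv F 6 + K10A.bv F 8, K10A.bv F 7 + K10A.bv F 9,
      K10A.bv F 6 - K10A.bv F 8, K10A.bv F 7 - K10A.bv F 9]
    ![1, 1, 1, h, g * g * h, g⁻¹ * g⁻¹ * h, g, g⁻¹, g * h, g⁻¹ * h]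

end GradingDefs

end Kac

namespace Kac

section Gradings

variable {G S A : Type} [CommGroup G] [CommRing S] [AddCommGroup A] [Module S A]

section Mul

variable [Mul A] {ev od : Submodule S A} {n : ℕ}

lemma GradIso.trans {G : Type} {Γ Γ' Γ'' : G → Submodule S A} (h : GradIso ev od Γ Γ')
    (h' : GradIso ev od Γ' Γ'') : GradIso ev od Γ Γ'' := by
  obtain ⟨φ, hφ⟩ := h
  obtain ⟨ψ, hψ⟩ := h'
  refine ⟨ψ * φ, fun g => ?_⟩
  rw [← hψ, ← hφ, ← Submodule.map_comp]
  rfl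

lemma GradIso.refl {G : Type} (Γ : G → Submodule S A) : GradIso ev od Γ Γ :=
  ⟨1, fun _ => Submodule.map_id _⟩

/-- An automorphism that permutes homogeneous bases up to signs, compatibly with the degrees,
is an isomorphism of gradings. -/
lemma gradIso_gradingOf (φ : SuperAut S A ev od) {w w' : Fin n → A} {d d' : Fin n → G}
    (π : Equiv.Perm (Fin n)) (c : Fin n → ℤˣ)
    (hw : ∀ i, φ.e (w i) = c i • w' (π i)) (hd : ∀ i, d' (π i) = d i) :
    GradIso ev od (gradingOf S w d) (gradingOf S w' d') := by
  refine ⟨φ, fun g => le_antisymm ?_ ?_⟩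
  · rw [gradingOf, Submodule.map_span, Submodule.span_le]
    rintro _ ⟨_, ⟨i, hi, rfl⟩, rfl⟩
    have hmem : w' (π i) ∈ gradingOf S w' d' g :=
      Submodule.subset_span ⟨π i, (hd i).trans hi, rfl⟩
    change φ.e (w i) ∈ _
    rw [hw]
    rcases Int.units_eq_one_or (c i) with h | h <;> simpa [h] using hmem
  · rw [gradingOf, Submodule.span_le]
    rintro _ ⟨j, hj, rfl⟩
    obtain ⟨i, rfl⟩ := π.surjective j
    have hmem : φ.e (w i) ∈ (gradingOf S w d g).map φ.e.toLinearMap :=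
      ⟨w i, Submodule.subset_span ⟨i, (hd i).symm.trans hj, rfl⟩, rfl⟩
    rw [hw] at hmem
    rcases Int.units_eq_one_or (c i) with h | h
    · rwa [h, one_smul] at hmem
    · rwa [h, Units.neg_smul, one_smul, neg_mem_iff] at hmem

end Mul

variable {n : ℕ}

lemma gradingOf_inf {p q : Submodule S A} (hpq : p ⊓ q = ⊥) {w : Fin n → A} (d : Fin n → G)
    (s : Finset (Fin n)) (hp : ∀ i ∈ s, w i ∈ p) (hq : ∀ i ∉ s, w i ∈ q) (g : G) :
    gradingOf S w d g ⊓ p = Submodule.span S (w '' {i | i ∈ s ∧ d i = g}) := by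
  have hsplit : {i | d i = g} = {i | i ∈ s ∧ d i = g} ∪ {i | i ∉ s ∧ d i = g} := by
    ext i; by_cases hi : i ∈ s <;> simp [hi]
  have h1 : Submodule.span S (w '' {i | i ∈ s ∧ d i = g}) ≤ p := by
    rw [Submodule.span_le]; rintro _ ⟨i, hi, rfl⟩; exact hp i hi.1
  have h2 : Submodule.span S (w '' {i | i ∉ s ∧ d i = g}) ≤ q := by
    rw [Submodule.span_le]; rintro _ ⟨i, hi, rfl⟩; exact hq i hi.1
  have h3 : Submodule.span S (w '' {i | i ∉ s ∧ d i = g}) ⊓ p = ⊥ := by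
    rw [eq_bot_iff, ← hpq, inf_comm]; exact inf_le_inf_left p h2
  rw [gradingOf, hsplit, Set.image_union, Submodule.span_union, sup_inf_assoc_of_le _ h1, h3,
    sup_bot_eq]

/-- Corresponding homogeneous parts of isomorphic gradings carry the same multiset of degrees. -/
lemma map_degree_eq [Nontrivial S] {p q : Submodule S A} (hpq : p ⊓ q = ⊥) (e : A ≃ₗ[S] A)
    (he : p.map e.toLinearMap = p) {w w' : Fin n → A} {d d' : Fin n → G}
    (hli : LinearIndependent S w) (hli' : LinearIndependent S w')
    (s : Finset (Fin n)) (hp : ∀ i ∈ s, w i ∈ p) (hq : ∀ i ∉ s, w i ∈ q)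
    (hp' : ∀ i ∈ s, w' i ∈ p) (hq' : ∀ i ∉ s, w' i ∈ q)
    (hmap : ∀ g, (gradingOf S w d g).map e.toLinearMap = gradingOf S w' d' g) :
    s.val.map d = s.val.map d' := by
  classical
  have hrank : ∀ (w : Fin n → A) (d : Fin n → G), LinearIndependent S w → ∀ g,
      Module.finrank S (Submodule.span S (w '' {i | i ∈ s ∧ d i = g})) =
        (s.val.map d).count g := by
    intro w d hw g
    have hcard := finrank_span_eq_card (R := S)
      (hw.comp (Subtype.val : {i // i ∈ s ∧ d i = g} → Fin n) Subtype.val_injective)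
    rw [Set.range_comp, Subtype.range_val_subtype, Fintype.card_subtype] at hcard
    rw [hcard, Multiset.count_map, Finset.card_def]
    congr 1
    rw [← Finset.filter_val]
    congr 1
    ext i
    simp [eq_comm]
  ext g
  rw [← hrank w d hli, ← hrank w' d' hli', ← gradingOf_inf hpq d s hp hq g,
    ← gradingOf_inf hpq d' s hp' hq' g, ← hmap, ← he, ← Submodule.map_inf _ e.injective, he]
  exact (LinearEquiv.finrank_eq (e.submoduleMap _))

end Gradings

namespace K10A

variable (F : Type) [Field F] {G : Type} [CommGroup G]

lemma bv_apply (i j : Fin 10) : bv F i j = if j = i then 1 else 0 :=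
  Pi.single_apply i (1 : F) j

/-- The homogeneous basis underlying the gradings `Γ²`. -/
def bv2 : Fin 10 → K10A F F :=
  ![bv F 0, bv F 1, bv F 3 - bv F 4, bv F 3 + bv F 4, bv F 2, bv F 5,
    bv F 6 + bv F 8, bv F 7 + bv F 9, bv F 6 - bv F 8, bv F 7 - bv F 9]

lemma linearIndependent_bv : LinearIndependent F (bv F) :=
  Pi.linearIndependent_single_one (Fin 10) F

lemma linearIndependent_bv2 (hchar : (2 : F) ≠ 0) : LinearIndependent F (bv2 F) := by
  rw [Fintype.linearIndependent_iff]
  intro c hc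
  have hcoord (j : Fin 10) := congrFun hc j
  have h0 := hcoord 0
  have h1 := hcoord 1
  have h2 := hcoord 2
  have h3 := hcoord 3
  have h4 := hcoord 4
  have h5 := hcoord 5
  have h6 := hcoord 6
  have h7 := hcoord 7
  have h8 := hcoord 8
  have h9 := hcoord 9
  simp [Fin.sum_univ_succ, bv2, bv_apply, Fin.ext_iff] at h0 h1 h2 h3 h4 h5 h6 h7 h8 h9
  have key : ∀ a b : F, a + b = 0 → -a + b = 0 → a = 0 ∧ b = 0 := by
    intro a b hab hab'
    have hb : b = 0 := by
      refine (mul_eq_zero.mp (?_ : (2 : F) * b = 0)).resolve_left hchar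
      linear_combination hab + hab'
    exact ⟨by simpa [hb] using hab, hb⟩
  have h34 := key _ _ h3 h4
  have h68 := key (c 8) (c 6) (by rw [add_comm, h6]) (by rw [add_comm, h8])
  have h79 := key (c 9) (c 7) (by rw [add_comm, h7]) (by rw [add_comm, h9])
  intro i
  fin_cases i
  exacts [h0, h1, h34.1, h34.2, h2, h5, h68.2, h79.2, h68.1, h79.1]

/-- The indices of the even elements of a homogeneous basis. -/
def evenIdx : Finset (Fin 10) := {0, 1, 2, 3, 4, 5}

lemma compl_evenIdx : evenIdxᶜ = {6, 7, 8, 9} := by decide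

lemma mem_even_iff (x : K10A F F) : x ∈ even F F F ↔ ∀ i ∉ evenIdx, x i = 0 := by
  change (∀ i : Fin 10, _ → _) ↔ _
  simp [evenIdx]

lemma mem_odd_iff (x : K10A F F) : x ∈ odd F F F ↔ ∀ i ∈ evenIdx, x i = 0 := by
  change (∀ i : Fin 10, _ → _) ↔ _
  refine forall_congr' fun i => ?_
  fin_cases i <;> simp [evenIdx]

lemma even_inf_odd : even F F F ⊓ odd F F F = ⊥ := by
  rw [eq_bot_iff]
  rintro x ⟨hx, hx'⟩
  funext i
  by_cases hi : i ∈ evenIdx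
  · exact (mem_odd_iff F x).1 hx' i hi
  · exact (mem_even_iff F x).1 hx i hi

lemma bv_mem_even (i : Fin 10) (hi : i ∈ evenIdx) : bv F i ∈ even F F F := by
  rw [mem_even_iff]
  intro j hj
  rw [bv_apply, if_neg]
  rintro rfl
  exact hj hi

lemma bv_mem_odd (i : Fin 10) (hi : i ∉ evenIdx) : bv F i ∈ odd F F F := by
  rw [mem_odd_iff]
  intro j hj
  rw [bv_apply, if_neg]
  rintro rfl
  exact hi hj

lemma bv2_mem_even (i : Fin 10) (hi : i ∈ evenIdx) : bv2 F i ∈ even F F F := by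
  have h (i : Fin 10) (hi : i ∈ evenIdx) := bv_mem_even F i hi
  fin_cases i <;> first
    | exact absurd hi (by decide)
    | exact h _ (by decide)
    | exact add_mem (h _ (by decide)) (h _ (by decide))
    | exact sub_mem (h _ (by decide)) (h _ (by decide))

lemma bv2_mem_odd (i : Fin 10) (hi : i ∉ evenIdx) : bv2 F i ∈ odd F F F := by
  have h (i : Fin 10) (hi : i ∉ evenIdx) := bv_mem_odd F i hi
  fin_cases i <;> first
    | exact absurd hi (by decide)
    | exact add_mem (h _ (by decide)) (h _ (by decide))
    | exact sub_mem (h _ (by decide)) (h _ (by decide))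

variable {F}

lemma GradIso.map_degree_eq {w w' : Fin 10 → K10A F F} {d d' : Fin 10 → G}
    (hli : LinearIndependent F w) (hli' : LinearIndependent F w')
    (hev : ∀ i ∈ evenIdx, w i ∈ even F F F) (hod : ∀ i ∉ evenIdx, w i ∈ odd F F F)
    (hev' : ∀ i ∈ evenIdx, w' i ∈ even F F F) (hod' : ∀ i ∉ evenIdx, w' i ∈ odd F F F)
    (h : GradIso (even F F F) (odd F F F) (gradingOf F w d) (gradingOf F w' d')) :
    evenIdx.val.map d = evenIdx.val.map d' ∧ evenIdxᶜ.val.map d = evenIdxᶜ.val.map d' := by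
  obtain ⟨φ, hφ⟩ := h
  refine ⟨Kac.map_degree_eq (even_inf_odd F) φ.e φ.map_even hli hli' _ hev hod hev' hod' hφ,
    Kac.map_degree_eq ((inf_comm _ _).trans (even_inf_odd F)) φ.e φ.map_odd hli hli' _
      ?_ ?_ ?_ ?_ hφ⟩ <;> simpa

/-- The linear automorphism of `K₁₀` permuting the coordinates by `σ` with signs `s`. -/
def signedPerm (σ : Equiv.Perm (Fin 10)) (s : Fin 10 → ℤˣ) : K10A F F ≃ₗ[F] K10A F F where
  toFun x i := s i • x (σ i)
  invFun x i := s (σ.symm i) • x (σ.symm i)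
  map_add' x y := by funext i; exact smul_add _ _ _
  map_smul' c x := by funext i; exact smul_comm (s i) c (x (σ i))
  left_inv x := by funext i; simp [smul_smul]
  right_inv x := by funext i; simp [smul_smul]

lemma signedPerm_apply (σ : Equiv.Perm (Fin 10)) (s : Fin 10 → ℤˣ) (x : K10A F F) (i : Fin 10) :
    signedPerm σ s x i = s i • x (σ i) := rfl

lemma signedPerm_symm_apply (σ : Equiv.Perm (Fin 10)) (s : Fin 10 → ℤˣ) (x : K10A F F)
    (i : Fin 10) : (signedPerm σ s).symm x i = s (σ.symm i) • x (σ.symm i) := rfl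

lemma signedPerm_bv (σ : Equiv.Perm (Fin 10)) (s : Fin 10 → ℤˣ) (i : Fin 10) :
    signedPerm σ s (bv F i) = s (σ⁻¹ i) • bv F (σ⁻¹ i) := by
  funext j
  change s j • bv F i (σ j) = s (σ⁻¹ i) • bv F (σ⁻¹ i) j
  rw [bv_apply, bv_apply]
  by_cases h : σ j = i
  · subst h; simp
  · rw [if_neg h, if_neg (mt Equiv.Perm.eq_inv_iff_eq.1 h), smul_zero, smul_zero]

lemma map_signedPerm (σ : Equiv.Perm (Fin 10)) (s : Fin 10 → ℤˣ) {t : Finset (Fin 10)}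
    (ht : ∀ i, σ i ∈ t ↔ i ∈ t) {p : Submodule F (K10A F F)}
    (hp : ∀ x, x ∈ p ↔ ∀ i ∈ t, x i = 0) :
    p.map (signedPerm σ s).toLinearMap = p := by
  ext x
  rw [Submodule.mem_map_equiv, hp, hp, ← σ.forall_congr_right]
  refine forall_congr' fun i => ?_
  rw [signedPerm_symm_apply, Equiv.symm_apply_apply, ht, smul_eq_zero_iff_eq]

/-- A multiplicative signed permutation of the coordinates preserving parity. -/
def signedPermAut (σ : Equiv.Perm (Fin 10)) (s : Fin 10 → ℤˣ)
    (hσ : ∀ i, σ i ∈ evenIdx ↔ i ∈ evenIdx)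
    (hmul : ∀ x y : K10A F F, signedPerm σ s (x * y) = signedPerm σ s x * signedPerm σ s y) :
    SuperAut F (K10A F F) (even F F F) (odd F F F) where
  e := signedPerm σ s
  map_mul' := hmul
  map_even := map_signedPerm σ s (t := evenIdxᶜ)
    (fun i => by simp only [Finset.mem_compl, hσ]) fun x => by
      simp only [mem_even_iff, Finset.mem_compl]
  map_odd := map_signedPerm σ s hσ (mem_odd_iff F)

variable (F) in
/-- The exchange automorphism `τ`. -/
def tau : SuperAut F (K10A F F) (even F F F) (odd F F F) :=
  signedPermAut (.swap 3 4 * .swap 6 8 * .swap 7 9) ![1, 1, -1, -1, -1, -1, 1, 1, 1, 1]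
    (by decide) fun x y => by
      funext i
      fin_cases i <;>
        simp [signedPerm_apply, mul_def, mulFun, Equiv.swap_apply_def, Fin.ext_iff,
          Units.smul_def] <;> ring

variable (F) in
/-- The automorphism induced by `u ↦ v`, `v ↦ -u` in the left factor. -/
def rotLeft : SuperAut F (K10A F F) (even F F F) (odd F F F) :=
  signedPermAut (.swap 2 4 * .swap 3 5 * .swap 6 7) ![1, 1, -1, -1, 1, 1, -1, 1, 1, 1]
    (by decide) fun x y => by
      funext i
      fin_cases i <;>
        simp [signedPerm_apply, mul_def, mulFun, Equiv.swap_apply_def, Fin.ext_iff,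
          Units.smul_def] <;> ring

variable (F) in
/-- The automorphism induced by `u ↦ v`, `v ↦ -u` in both factors. -/
def rotBoth : SuperAut F (K10A F F) (even F F F) (odd F F F) :=
  signedPermAut (.swap 2 5 * .swap 3 4 * .swap 6 7 * .swap 8 9)
    ![1, 1, 1, -1, -1, 1, -1, 1, -1, 1]
    (by decide) fun x y => by
      funext i
      fin_cases i <;>
        simp [signedPerm_apply, mul_def, mulFun, Equiv.swap_apply_def, Fin.ext_iff,
          Units.smul_def] <;> ring

variable (F) in
/-- The automorphism induced by `-1` on `W` in the right factor. -/
def negRight : SuperAut F (K10A F F) (even F F F) (odd F F F) :=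
  signedPermAut 1 ![1, 1, -1, -1, -1, -1, 1, 1, -1, -1]
    (by decide) fun x y => by
      funext i
      fin_cases i <;> simp [signedPerm_apply, mul_def, mulFun, Units.smul_def] <;> ring

variable (F)

lemma gamma1_swap (g1 g2 : G) :
    GradIso (even F F F) (odd F F F) (gamma1 F g1 g2) (gamma1 F g2 g1) :=
  gradIso_gradingOf (tau F) _ _ (signedPerm_bv _ _) fun i => by
    fin_cases i <;> simp [Equiv.swap_apply_def, mul_comm]

lemma gamma1_inv_left (g1 g2 : G) :
    GradIso (even F F F) (odd F F F) (gamma1 F g1 g2) (gamma1 F g1⁻¹ g2) :=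
  gradIso_gradingOf (rotLeft F) _ _ (signedPerm_bv _ _) fun i => by
    fin_cases i <;> simp [Equiv.swap_apply_def]

lemma gamma1_inv_right (g1 g2 : G) :
    GradIso (even F F F) (odd F F F) (gamma1 F g1 g2) (gamma1 F g1 g2⁻¹) :=
  ((gamma1_swap F g1 g2).trans (gamma1_inv_left F g2 g1)).trans (gamma1_swap F _ _)

lemma gamma2_inv (g h : G) :
    GradIso (even F F F) (odd F F F) (gamma2 F g h) (gamma2 F g⁻¹ h) :=
  gradIso_gradingOf (rotBoth F) (.swap 4 5 * .swap 6 7 * .swap 8 9)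
    ![1, 1, 1, -1, 1, 1, 1, -1, 1, -1]
    (fun i => by
      change signedPerm _ _ _ = _
      fin_cases i <;> simp [signedPerm_bv, Equiv.swap_apply_def] <;> try abel)
    fun i => by fin_cases i <;> simp [Equiv.swap_apply_def]

lemma gamma2_mul (g : G) {h : G} (hh : h * h = 1) :
    GradIso (even F F F) (odd F F F) (gamma2 F g h) (gamma2 F (g * h) h) :=
  gradIso_gradingOf (negRight F) (.swap 6 8 * .swap 7 9)
    ![1, 1, -1, -1, -1, -1, 1, 1, 1, 1]
    (fun i => by
      change signedPerm _ _ _ = _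
      fin_cases i <;> simp [signedPerm_bv, Equiv.swap_apply_def] <;> try abel)
    fun i => by
      have hinv : h⁻¹ = h := inv_eq_of_mul_eq_one_left hh
      have hg (x : G) : x * h * h = x := by rw [mul_assoc, hh, mul_one]
      have hgg (x : G) : x * h * (x * h) = x * x := by rw [mul_mul_mul_comm, hh, mul_one]
      fin_cases i <;> simp [Equiv.swap_apply_def, hinv, hg, hgg, mul_inv, -mul_inv_rev]

variable {F}

lemma degree_eq_of_gamma1_gamma1 {g1 g2 g1' g2' : G}
    (h : GradIso (even F F F) (odd F F F) (gamma1 F g1 g2) (gamma1 F g1' g2')) :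
    ({g1, g1⁻¹, g2, g2⁻¹} : Set G) = {g1', g1'⁻¹, g2', g2'⁻¹} := by
  have hdeg := (GradIso.map_degree_eq (linearIndependent_bv F) (linearIndependent_bv F)
    (bv_mem_even F) (bv_mem_odd F) (bv_mem_even F) (bv_mem_odd F) h).2
  ext x
  have hx := congrArg (x ∈ ·) hdeg
  simpa [compl_evenIdx, eq_comm] using hx

lemma prod_degree_even_gamma2 (g : G) {h : G} (hh : h * h = 1) :
    h * (g * g * h * (g⁻¹ * g⁻¹ * h)) = h := by
  rw [mul_mul_mul_comm, mul_mul_mul_comm g g]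
  simp [hh]

lemma not_gradIso_gamma1_gamma2 (hchar : (2 : F) ≠ 0) {g1 g2 g h : G} (hh : h * h = 1)
    (hne : h ≠ 1) :
    ¬ GradIso (even F F F) (odd F F F) (gamma1 F g1 g2) (gamma2 F g h) := fun hiso => by
  have hdeg := (GradIso.map_degree_eq (linearIndependent_bv F) (linearIndependent_bv2 F hchar)
    (bv_mem_even F) (bv_mem_odd F) (bv2_mem_even F) (bv2_mem_odd F) hiso).1
  have hprod := congrArg Multiset.prod hdeg
  simp [evenIdx, prod_degree_even_gamma2 g hh] at hprod
  exact hne (by simpa [mul_left_comm, mul_assoc] using hprod.symm)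

lemma degree_eq_of_gamma2_gamma2 (hchar : (2 : F) ≠ 0) {g h g' h' : G} (hh : h * h = 1)
    (hh' : h' * h' = 1)
    (hiso : GradIso (even F F F) (odd F F F) (gamma2 F g h) (gamma2 F g' h')) :
    h' = h ∧ g' ∈ ({g, g * h, g⁻¹, g⁻¹ * h} : Set G) := by
  have hdeg := GradIso.map_degree_eq (linearIndependent_bv2 F hchar)
    (linearIndependent_bv2 F hchar)
    (bv2_mem_even F) (bv2_mem_odd F) (bv2_mem_even F) (bv2_mem_odd F) hiso
  have hprod := congrArg Multiset.prod hdeg.1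
  have hmem := congrArg (g' ∈ ·) hdeg.2
  simp [evenIdx, prod_degree_even_gamma2, hh, hh'] at hprod
  simp [compl_evenIdx] at hmem
  exact ⟨hprod.symm, by simp; tauto⟩

lemma gamma1_congr {g1 g2 g1' g2' : G}
    (h : ({g1, g1⁻¹, g2, g2⁻¹} : Set G) = {g1', g1'⁻¹, g2', g2'⁻¹}) :
    GradIso (even F F F) (odd F F F) (gamma1 F g1 g2) (gamma1 F g1' g2') := by
  have hiff (x : G) := Set.ext_iff.1 h x
  simp only [Set.mem_insert_iff, Set.mem_singleton_iff] at hiff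
  have hpair : ((g1' = g1 ∨ g1' = g1⁻¹) ∧ (g2' = g2 ∨ g2' = g2⁻¹)) ∨
      ((g1' = g2 ∨ g1' = g2⁻¹) ∧ (g2' = g1 ∨ g2' = g1⁻¹)) := by
    have hinv (x : G) : x⁻¹⁻¹ = x := inv_inv x
    have e1 := (hiff g1').2 (by simp)
    have e2 := (hiff g2').2 (by simp)
    have e3 := (hiff g1).1 (by simp)
    have e4 := (hiff g2).1 (by simp)
    clear hiff h
    grind
  have hunits (x y : G) {x' y' : G} (hx : x' = x ∨ x' = x⁻¹) (hy : y' = y ∨ y' = y⁻¹) :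
      GradIso (even F F F) (odd F F F) (gamma1 F x y) (gamma1 F x' y') := by
    rcases hx with rfl | rfl <;> rcases hy with rfl | rfl
    · exact GradIso.refl _
    · exact gamma1_inv_right F _ _
    · exact gamma1_inv_left F _ _
    · exact (gamma1_inv_left F _ _).trans (gamma1_inv_right F _ _)
  rcases hpair with ⟨h1, h2⟩ | ⟨h1, h2⟩
  · exact hunits _ _ h1 h2
  · exact (gamma1_swap F _ _).trans (hunits _ _ h1 h2)

lemma gamma2_congr {g h g' : G} (hh : h * h = 1)
    (hg : g' ∈ ({g, g * h, g⁻¹, g⁻¹ * h} : Set G)) :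
    GradIso (even F F F) (odd F F F) (gamma2 F g h) (gamma2 F g' h) := by
  rcases hg with rfl | rfl | rfl | rfl
  · exact GradIso.refl _
  · exact gamma2_mul F _ hh
  · exact gamma2_inv F _ _
  · exact (gamma2_inv F _ _).trans (gamma2_mul F _ hh)

end K10A

end Kac

/-! ### STATEMENT 18 -/

open Kac in
/-- (i) No `Γ¹_{K₁₀}(G; g₁, g₂)` is isomorphic to a `Γ²_{K₁₀}(G; g, h)`;
(ii) `Γ¹_{K₁₀}(G; g₁, g₂) ≅ Γ¹_{K₁₀}(G; g₁', g₂')` iff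
`{g₁, g₁⁻¹, g₂, g₂⁻¹} = {g₁', g₁'⁻¹, g₂', g₂'⁻¹}`;
(iii) for `h, h'` of order two, `Γ²_{K₁₀}(G; g, h) ≅ Γ²_{K₁₀}(G; g', h')` iff
`h' = h` and `g' ∈ {g, gh, g⁻¹, g⁻¹h}`. -/
theorem gradings_on_K10_iso_classification (F : Type) [Field F] (hchar : (2 : F) ≠ 0)
    (G : Type) [CommGroup G] :
    (∀ g1 g2 g h : G, h * h = 1 → h ≠ 1 →
      ¬ GradIso (K10A.even F F F) (K10A.odd F F F)
          (K10A.gamma1 F g1 g2) (K10A.gamma2 F g h)) ∧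
    (∀ g1 g2 g1' g2' : G,
      GradIso (K10A.even F F F) (K10A.odd F F F)
          (K10A.gamma1 F g1 g2) (K10A.gamma1 F g1' g2') ↔
        ({g1, g1⁻¹, g2, g2⁻¹} : Set G) = {g1', g1'⁻¹, g2', g2'⁻¹}) ∧
    (∀ g h g' h' : G, h * h = 1 → h ≠ 1 → h' * h' = 1 → h' ≠ 1 →
      (GradIso (K10A.even F F F) (K10A.odd F F F)
          (K10A.gamma2 F g h) (K10A.gamma2 F g' h') ↔
        (h' = h ∧ g' ∈ ({g, g * h, g⁻¹, g⁻¹ * h} : Set G)))) := by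
  refine ⟨fun g1 g2 g h hh hne => K10A.not_gradIso_gamma1_gamma2 hchar hh hne,
    fun g1 g2 g1' g2' => ⟨K10A.degree_eq_of_gamma1_gamma1, K10A.gamma1_congr⟩,
    fun g h g' h' hh _ hh' _ => ⟨K10A.degree_eq_of_gamma2_gamma2 hchar hh hh', ?_⟩⟩
  rintro ⟨rfl, hg⟩
  exact K10A.gamma2_congr hh hg
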